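/- arXiv:cs/9809003 — 3 statements merged into one kernel-verified Lean document; each statement's English description precedes it below -/
import Mathlib

section
/- For every event e, every ε ∈ ℕ, and every set G of agents, the assignment 𝓔(i) = K_i(C^ε_G e) for i ∈ G is an ensemble for G (i.e., each event K_i(C^ε_G e) is local to agent i) and this ensemble is ε-coordinated. -/
open Set

/-- Agent `i`'s knowledge operator: `(r,m) ∈ Kn st i e` iff `e` holds at all points
whose local state for `i` agrees with that of `(r,m)`. -/
def Kn {A Se : Type*} {S : A → Type*} {R : Type*}
    (st : R → ℕ → Se × (∀ i, S i)) (i : A) (e : Set (R × ℕ)) : Set (R × ℕ) :=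
  {p | ∀ q : R × ℕ, (st q.1 q.2).2 i = (st p.1 p.2).2 i → q ∈ e}

/-- Everyone in `G` knows `e`. -/
def En {A Se : Type*} {S : A → Type*} {R : Type*}
    (st : R → ℕ → Se × (∀ i, S i)) (G : Set A) (e : Set (R × ℕ)) : Set (R × ℕ) :=
  ⋂ i ∈ G, Kn st i e

/-- Common knowledge among `G` of `e`: the intersection of all iterates `(E_G)^k e`, `k ≥ 1`. -/
def Cn {A Se : Type*} {S : A → Type*} {R : Type*}
    (st : R → ℕ → Se × (∀ i, S i)) (G : Set A) (e : Set (R × ℕ)) : Set (R × ℕ) :=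
  ⋂ k ≥ 1, (En st G)^[k] e

/-- An event `e` is local to agent `i` if membership depends only on `i`'s local state. -/
def IsLocal {A Se : Type*} {S : A → Type*} {R : Type*}
    (st : R → ℕ → Se × (∀ i, S i)) (i : A) (e : Set (R × ℕ)) : Prop :=
  ∀ p q : R × ℕ, (st p.1 p.2).2 i = (st q.1 q.2).2 i → (p ∈ e ↔ q ∈ e)

/-- `E^ε_G e`: there is an interval `[m', m'+ε]` containing the current time such that
every agent in `G` knows `e` at some point of the interval. -/
def Eeps {A Se : Type*} {S : A → Type*} {R : Type*}
    (st : R → ℕ → Se × (∀ i, S i)) (ε : ℕ) (G : Set A) (e : Set (R × ℕ)) :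
    Set (R × ℕ) :=
  {p | ∃ m' : ℕ, m' ≤ p.2 ∧ p.2 ≤ m' + ε ∧
    ∀ i ∈ G, ∃ mi : ℕ, m' ≤ mi ∧ mi ≤ m' + ε ∧ (p.1, mi) ∈ Kn st i e}

/-- `ε`-common knowledge `C^ε_G e`: the greatest fixed point `ν x [E^ε_G (e ∩ x)]`. -/
def Ceps {A Se : Type*} {S : A → Type*} {R : Type*}
    (st : R → ℕ → Se × (∀ i, S i)) (ε : ℕ) (G : Set A) (e : Set (R × ℕ)) :
    Set (R × ℕ) :=
  ⋃₀ {x : Set (R × ℕ) | x ⊆ Eeps st ε G (e ∩ x)}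

/-- An ensemble `𝓔` for `G` is `ε`-coordinated if whenever some `𝓔(i)` holds, all the
events `𝓔(j)`, `j ∈ G`, hold within a single interval of `ε` time units containing the
current time. -/
def EpsCoordinated {A Se : Type*} {S : A → Type*} {R : Type*}
    (st : R → ℕ → Se × (∀ i, S i)) (ε : ℕ) (G : Set A) (𝓔 : A → Set (R × ℕ)) : Prop :=
  ∀ (r : R) (m : ℕ), ∀ i ∈ G, (r, m) ∈ 𝓔 i →
    ∃ m' : ℕ, m' ≤ m ∧ m ≤ m' + ε ∧
      ∀ j ∈ G, ∃ mj : ℕ, m' ≤ mj ∧ mj ≤ m' + ε ∧ (r, mj) ∈ 𝓔 j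

theorem Kn_mono {A Se : Type*} {S : A → Type*} {R : Type*}
    (st : R → ℕ → Se × (∀ i, S i)) (i : A) : Monotone (Kn st i) :=
  fun _ _ h _ hp q hq => h (hp q hq)

theorem Kn_subset {A Se : Type*} {S : A → Type*} {R : Type*}
    (st : R → ℕ → Se × (∀ i, S i)) (i : A) (e : Set (R × ℕ)) : Kn st i e ⊆ e :=
  fun p hp => hp p rfl

theorem isLocal_Kn {A Se : Type*} {S : A → Type*} {R : Type*}
    (st : R → ℕ → Se × (∀ i, S i)) (i : A) (e : Set (R × ℕ)) : IsLocal st i (Kn st i e) :=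
  fun _ _ h => ⟨fun hp s hs => hp s (hs.trans h.symm), fun hq s hs => hq s (hs.trans h)⟩

theorem Eeps_mono {A Se : Type*} {S : A → Type*} {R : Type*}
    (st : R → ℕ → Se × (∀ i, S i)) (ε : ℕ) (G : Set A) : Monotone (Eeps st ε G) := by
  rintro e e' h p ⟨m', h₁, h₂, hG⟩
  refine ⟨m', h₁, h₂, fun i hi => ?_⟩
  obtain ⟨mi, h₃, h₄, hk⟩ := hG i hi
  exact ⟨mi, h₃, h₄, Kn_mono st i h hk⟩

/-- `ε`-common knowledge is a post-fixed point of `x ↦ E^ε_G (e ∩ x)`. -/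
theorem Ceps_subset_Eeps {A Se : Type*} {S : A → Type*} {R : Type*}
    (st : R → ℕ → Se × (∀ i, S i)) (ε : ℕ) (G : Set A) (e : Set (R × ℕ)) :
    Ceps st ε G e ⊆ Eeps st ε G (e ∩ Ceps st ε G e) :=
  sUnion_subset fun _ hx =>
    hx.trans (Eeps_mono st ε G (inter_subset_inter_right e (subset_sUnion_of_mem hx)))

/-- Proposition 5(a): for every event `e`, `ε ∈ ℕ`, and set `G` of
agents, the assignment `𝓔(i) = K_i (C^ε_G e)` is an ensemble for `G` (each event is local
to `i`) and this ensemble is `ε`-coordinated. -/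
theorem ensemble_KiCeps_eps_coordinated
    {A Se : Type*} {S : A → Type*} {R : Type*}
    (st : R → ℕ → Se × (∀ i, S i)) (e : Set (R × ℕ)) (ε : ℕ) (G : Set A) :
    (∀ i ∈ G, IsLocal st i (Kn st i (Ceps st ε G e))) ∧
    EpsCoordinated st ε G (fun i => Kn st i (Ceps st ε G e)) := by
  refine ⟨fun i _ => isLocal_Kn st i _, fun r m i _ h => ?_⟩
  exact Eeps_mono st ε G inter_subset_right (Ceps_subset_Eeps st ε G e (Kn_subset st i _ h))
end

section
/- (Fischer–Immerman) Let G be a nonempty finite set of agents in a finite-state system, i.e., each agent i ∈ G has a finite type S_i of local states. Then there exists k ∈ ℕ such that for every event e, C_G e = (E_G)^k e; that is, in a finite-state system, common knowledge among G is equivalent to E_G iterated k times for a sufficiently large k, uniformly in e. -/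
open Set

/-- A deflationary self-map of a partial order whose range is finite has iterates that
stabilize uniformly in the starting point. -/
theorem exists_forall_iterate_eq_of_finite_range {α : Type*} [PartialOrder α] (f : α → α)
    (hf : ∀ x, f x ≤ x) (hfin : (range f).Finite) :
    ∃ k, ∀ x, ∀ n ≥ k, f^[n] x = f^[k] x := by
  have : Finite (range f) := hfin
  have : Finite (range f → range f)ᵒᵈ := inferInstanceAs (Finite (range f → range f))
  let g : ℕ →o (range f → range f)ᵒᵈ :=
    ⟨fun n => OrderDual.toDual fun y => ⟨f (f^[n] y), mem_range_self _⟩,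
      monotone_nat_of_le_succ fun n y => by
        change f (f^[n + 1] (y : α)) ≤ f (f^[n] (y : α))
        rw [Function.iterate_succ_apply']
        exact hf _⟩
  obtain ⟨m, hm⟩ := WellFoundedGT.monotone_chain_condition g
  refine ⟨m + 2, fun x n hn => ?_⟩
  obtain ⟨j, rfl⟩ := Nat.exists_eq_add_of_le' (le_trans (Nat.le_add_left 2 m) hn)
  have h : f (f^[m] (f x)) = f (f^[j] (f x)) :=
    congrArg Subtype.val (congrFun (hm j (by lia)) ⟨f x, mem_range_self x⟩)
  simpa only [← Function.iterate_succ_apply, ← Function.iterate_succ_apply'] using h.symm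

theorem En_subset {A Se : Type*} {S : A → Type*} {R : Type*}
    (st : R → ℕ → Se × (∀ i, S i)) {G : Set A} (hne : G.Nonempty) (e : Set (R × ℕ)) :
    En st G e ⊆ e := by
  obtain ⟨i, hi⟩ := hne
  exact fun p hp => mem_iInter₂.1 hp i hi p rfl

theorem finite_range_En {A Se : Type*} {S : A → Type*} {R : Type*}
    (st : R → ℕ → Se × (∀ i, S i)) {G : Set A} (hGfin : G.Finite)
    (hSfin : ∀ i ∈ G, Finite (S i)) : (range (En st G)).Finite := by
  have : Finite G := hGfin
  have (i : G) : Finite (S i) := hSfin i i.2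
  let view : R × ℕ → ∀ i : G, S i := fun p i => (st p.1 p.2).2 i
  refine (finite_range (preimage view)).subset ?_
  rintro _ ⟨e, rfl⟩
  refine ⟨{t | ∀ i : G, ∀ q, view q i = t i → q ∈ e}, ?_⟩
  ext p
  simp [view, En, Kn]

/-- Fischer–Immerman: if `G` is a nonempty finite set of agents each of
whom has only finitely many local states, then there is a `k ∈ ℕ` such that for every
event `e`, common knowledge `C_G e` equals `(E_G)^k e`, uniformly in `e`. -/
theorem finite_state_common_knowledge_eq_iterate
    {A Se : Type*} {S : A → Type*} {R : Type*}
    (st : R → ℕ → Se × (∀ i, S i)) (G : Set A)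
    (hne : G.Nonempty) (hGfin : G.Finite)
    (hSfin : ∀ i ∈ G, Finite (S i)) :
    ∃ k : ℕ, ∀ e : Set (R × ℕ), Cn st G e = (En st G)^[k] e := by
  obtain ⟨k, hk⟩ := exists_forall_iterate_eq_of_finite_range (En st G) (En_subset st hne)
    (finite_range_En st hGfin hSfin)
  refine ⟨k + 1, fun e => Subset.antisymm (iInter₂_subset (k + 1) (by simp)) ?_⟩
  refine subset_iInter₂ fun n _ => ?_
  have hanti : Antitone fun n => (En st G)^[n] e := antitone_nat_of_succ_le fun n => by
    rw [Function.iterate_succ_apply']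
    exact En_subset st hne _
  rw [hk e (k + 1) k.le_succ, ← hk e (max k n) (le_max_left k n)]
  exact hanti (le_max_right k n)
end

section
/- For every event e and every nonempty set G of agents, 0-coordination-style common knowledge coincides with common knowledge: E^0_G e = E_G e, and C^0_G e = C_G e; that is, ε-common knowledge with ε = 0 is exactly common knowledge. -/
open Set

theorem mem_En {A Se : Type*} {S : A → Type*} {R : Type*}
    {st : R → ℕ → Se × (∀ i, S i)} {G : Set A} {e : Set (R × ℕ)} {p : R × ℕ} :
    p ∈ En st G e ↔
      ∀ i ∈ G, ∀ q : R × ℕ, (st q.1 q.2).2 i = (st p.1 p.2).2 i → q ∈ e := by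
  simp [En, Kn]

theorem En_mono {A Se : Type*} {S : A → Type*} {R : Type*}
    (st : R → ℕ → Se × (∀ i, S i)) (G : Set A) : Monotone (En st G) :=
  fun _ _ h _ hp => mem_En.2 fun i hi q hq => h (mem_En.1 hp i hi q hq)

theorem Eeps_zero {A Se : Type*} {S : A → Type*} {R : Type*}
    (st : R → ℕ → Se × (∀ i, S i)) (G : Set A) (e : Set (R × ℕ)) :
    Eeps st 0 G e = En st G e := by
  ext ⟨r, m⟩
  simp only [Eeps, En, mem_ofPred_eq, mem_iInter, add_zero]
  constructor
  · rintro ⟨m', h₁, h₂, h⟩ i hi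
    obtain ⟨mi, h₃, h₄, hk⟩ := h i hi
    obtain rfl : mi = m := by omega
    exact hk
  · exact fun h => ⟨m, le_rfl, le_rfl, fun i hi => ⟨m, le_rfl, le_rfl, h i hi⟩⟩

/-- Common knowledge is a post-fixed point of `x ↦ E_G (e ∩ x)`. -/
theorem Cn_subset_En {A Se : Type*} {S : A → Type*} {R : Type*}
    (st : R → ℕ → Se × (∀ i, S i)) (G : Set A) (e : Set (R × ℕ)) :
    Cn st G e ⊆ En st G (e ∩ Cn st G e) := by
  intro p hp
  have hp' : ∀ k, p ∈ En st G ((En st G)^[k] e) := fun k => by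
    rw [← Function.iterate_succ_apply' (En st G)]
    exact mem_iInter₂.1 hp (k + 1) (Nat.succ_pos k)
  exact mem_En.2 fun i hi q hq =>
    ⟨mem_En.1 (hp' 0) i hi q hq, mem_iInter₂.2 fun k _ => mem_En.1 (hp' k) i hi q hq⟩

/-- The induction rule for common knowledge. -/
theorem subset_Cn {A Se : Type*} {S : A → Type*} {R : Type*}
    {st : R → ℕ → Se × (∀ i, S i)} {G : Set A} {e x : Set (R × ℕ)}
    (hx : x ⊆ En st G (e ∩ x)) : x ⊆ Cn st G e := by
  refine subset_iInter₂ fun k hk => ?_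
  induction k, hk using Nat.le_induction with
  | base => exact hx.trans (En_mono st G inter_subset_left)
  | succ k _ ih =>
    rw [Function.iterate_succ_apply']
    exact hx.trans (En_mono st G (inter_subset_right.trans ih))

/-- with `ε = 0`, the `ε`-interval operators coincide with the usual
ones: `E^0_G e = E_G e` and `C^0_G e = C_G e`, for every event `e` and nonempty `G`. -/
theorem eps_zero_common_knowledge_eq
    {A Se : Type*} {S : A → Type*} {R : Type*}
    (st : R → ℕ → Se × (∀ i, S i)) (e : Set (R × ℕ)) (G : Set A)
    (hG : G.Nonempty) :
    Eeps st 0 G e = En st G e ∧ Ceps st 0 G e = Cn st G e := by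
  refine ⟨Eeps_zero st G e, subset_antisymm ?_ ?_⟩
  · refine sUnion_subset fun x hx => subset_Cn ?_
    rw [← Eeps_zero]
    exact hx
  · refine subset_sUnion_of_mem (?_ : Cn st G e ⊆ Eeps st 0 G (e ∩ Cn st G e))
    rw [Eeps_zero]
    exact Cn_subset_En st G e
end
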